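/- Pfaffian-tree theorem of Masbaum–Vaintrob as a special case: for n odd and a single completely antisymmetric 3-tensor y, the Berezin integral ∫ dχₙ⋯dχ₁ χᵢ exp( (1/2) Σ_{(α₁,α₂,α₃)∈[n]³} y_{α₁α₂α₃} χ_{α₂}χ_{α₃} ) equals (−1)^{i−1} Pf(A^{(i)}), where A is the skew-symmetric (n×n) matrix A_{α₂α₃} := Σ_{α₁} y_{α₁α₂α₃} and A^{(i)} is obtained by deleting row and column i; this quantity equals the sum over all 3-regular cacti (spanning 3-trees) of their amplitudes. -/

import Mathlib

set_option synthInstance.maxHeartbeats 1000000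
set_option maxHeartbeats 1000000

noncomputable section

variable {R : Type*} [CommRing R] [Algebra ℚ R]

/-- The Grassmann algebra on anticommuting generators indexed by `ι`,
realized as the exterior algebra of the free module `ι → R`. -/
abbrev GA (R : Type*) [CommRing R] (ι : Type*) : Type _ :=
  ExteriorAlgebra R (ι → R)

/-- The generator `χ i` of the Grassmann algebra. -/
def gaGen {R : Type*} [CommRing R] {ι : Type*} [DecidableEq ι] (i : ι) : GA R ι :=
  ExteriorAlgebra.ι R (Pi.single i 1)

/-- The odd derivation `∂/∂χ i` (left contraction with the `i`-th coordinate functional). -/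
def gaDeriv {R : Type*} [CommRing R] {ι : Type*} [DecidableEq ι] (i : ι) :
    GA R ι →ₗ[R] GA R ι :=
  CliffordAlgebra.contractLeft (Q := (0 : QuadraticForm R (ι → R))) (LinearMap.proj i)

/-- Iterated Berezin integration: `bint [τ 1, …, τ p] f = ∂/∂χ_{τ 1} ∘ ⋯ ∘ ∂/∂χ_{τ p} f`. -/
def bint {R : Type*} [CommRing R] {ι : Type*} [DecidableEq ι] :
    List ι → GA R ι → GA R ι
  | [], f => f
  | i :: t, f => gaDeriv i (bint t f)

/-- The scalar (degree-0) part of an element of the Grassmann algebra. -/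
def gaCoef {R : Type*} [CommRing R] {ι : Type*} : GA R ι →ₐ[R] R :=
  ExteriorAlgebra.algebraMapInv

/-- The (terminating) exponential of an element of the augmentation ideal of the
Grassmann algebra on finitely many generators. -/
def gexp {R : Type*} [CommRing R] [Algebra ℚ R] {ι : Type*} [Fintype ι] (f : GA R ι) :
    GA R ι :=
  ∑ p ∈ Finset.range (Fintype.card ι + 1), algebraMap ℚ R (p.factorial : ℚ)⁻¹ • f ^ p


open scoped Classical

/-- The bipartite incidence graph of a family `𝒜` of subsets of `{1,…,n}`: one part is `𝒜`,
the other is `{1,…,n}`, with an edge between `A` and `j` whenever `j ∈ A`. -/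
def incGraph {n : ℕ} (𝒜 : Finset (Finset (Fin n))) :
    SimpleGraph ({A // A ∈ 𝒜} ⊕ Fin n) :=
  SimpleGraph.fromRel (fun x y =>
    match x, y with
    | Sum.inl A, Sum.inr j => j ∈ A.1
    | _, _ => False)

/-- `𝒜` is an (odd) cactus: all blocks have odd cardinality `≥ 3` and the bipartite
incidence graph is a tree (spanning all of `{1,…,n}`). -/
def IsCactus {n : ℕ} (𝒜 : Finset (Finset (Fin n))) : Prop :=
  (∀ A ∈ 𝒜, Odd A.card ∧ 3 ≤ A.card) ∧ (incGraph 𝒜).IsTree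

/-- The family of underlying blocks of a set of sequences. -/
def cactusOf {n : ℕ} (C : Finset (Σ k : ℕ, Fin k → Fin n)) : Finset (Finset (Fin n)) :=
  C.image (fun a => Finset.image a.2 Finset.univ)

/-- `C` is a refined cactus: a set of injective sequences of odd length `≥ 3`, with pairwise
distinct underlying sets, whose family of underlying sets is a cactus. -/
def RefinedCactus {n : ℕ} (C : Finset (Σ k : ℕ, Fin k → Fin n)) : Prop :=
  (∀ a ∈ C, Odd a.1 ∧ 3 ≤ a.1 ∧ Function.Injective a.2) ∧
    Set.InjOn (fun a : Σ k : ℕ, Fin k → Fin n => Finset.image a.2 Finset.univ) ↑C ∧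
    IsCactus (cactusOf C)

/-- `l` is the circulation of the sequence `a` with respect to the global root `i`:
`a μ` is the local root of the block of `a` (the unique element of the block strictly
closer to `i` than the block vertex in the incidence tree), and `l` is the cyclic shift
of `a` starting just after `μ` with `a μ` deleted. -/
def IsCirculation {n : ℕ} (𝒜 : Finset (Finset (Fin n))) (i : Fin n)
    (a : Σ k : ℕ, Fin k → Fin n) (l : List (Fin n)) : Prop :=
  ∃ (μ : Fin a.1) (hA : Finset.image a.2 Finset.univ ∈ 𝒜),
    (incGraph 𝒜).dist (Sum.inr (a.2 μ)) (Sum.inr i) <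
        (incGraph 𝒜).dist (Sum.inl ⟨_, hA⟩) (Sum.inr i) ∧
      l = List.ofFn (fun t : Fin (a.1 - 1) =>
        a.2 ⟨((μ : ℕ) + (t : ℕ) + 1) % a.1, Nat.mod_lt _ μ.pos⟩)

/-- `pl` is a listing of `{1,…,n}` obtained by concatenating the root `i` followed by the
circulations of the elements of `C`, in some order. -/
def IsCactusList {n : ℕ} (C : Finset (Σ k : ℕ, Fin k → Fin n)) (i : Fin n)
    (pl : List (Fin n)) : Prop :=
  ∃ L : List ((Σ k : ℕ, Fin k → Fin n) × List (Fin n)),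
    (L.map Prod.fst).Nodup ∧ (L.map Prod.fst).toFinset = C ∧
      (∀ x ∈ L, IsCirculation (cactusOf C) i x.1 x.2) ∧
      pl = i :: (L.map Prod.snd).flatten

/-- The permutation of `Fin n` determined by a duplicate-free listing `l` of all of `Fin n`
(the identity if `l` is not such a listing). -/
noncomputable def listPerm {n : ℕ} (l : List (Fin n)) : Equiv.Perm (Fin n) :=
  if h : l.length = n ∧ l.Nodup then
    Equiv.ofBijective (fun t => l.get (Fin.cast h.1.symm t))
      (Finite.injective_iff_bijective.mp (fun s t hst => by
        have h2 := List.nodup_iff_injective_get.mp h.2 hst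
        exact Fin.val_injective (by simpa using congrArg Fin.val h2)))
  else 1

/-- The amplitude `Y_𝒜` of a cactus `𝒜`: `ε_{i,C} Π_{α∈C} y_α` for any (hence, by the
well-definedness lemma, every) choice of global root `i` and refined cactus `C`
with underlying cactus `𝒜` (and `0` if no such choice exists). -/
noncomputable def cactusAmp {R : Type*} [CommRing R] {n : ℕ}
    (y : ∀ k : ℕ, (Fin k → Fin n) → R) (𝒜 : Finset (Finset (Fin n))) : R :=
  if h : ∃ x : Finset (Σ k : ℕ, Fin k → Fin n) × Fin n × List (Fin n),
      RefinedCactus x.1 ∧ cactusOf x.1 = 𝒜 ∧ IsCactusList x.1 x.2.1 x.2.2 then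
    ((Equiv.Perm.sign (listPerm h.choose.2.2) : ℤ) : R) * ∏ a ∈ h.choose.1, y a.1 a.2
  else 0

/-- The Pfaffian of a `2m × 2m` matrix, `Pf(A) = (2^m m!)⁻¹ Σ_σ ε(σ) Π_i A_{σ(2i-1) σ(2i)}`. -/
noncomputable def pf {R : Type*} [CommRing R] [Algebra ℚ R] {m : ℕ}
    (A : Matrix (Fin (2 * m)) (Fin (2 * m)) R) : R :=
  algebraMap ℚ R ((2 ^ m * m.factorial : ℚ))⁻¹ *
    ∑ σ : Equiv.Perm (Fin (2 * m)), (Equiv.Perm.sign σ : ℤ) •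
      ∏ i : Fin m, A (σ ⟨2 * (i : ℕ), by omega⟩) (σ ⟨2 * (i : ℕ) + 1, by omega⟩)


set_option linter.unusedSectionVars false

namespace PT

open ExteriorAlgebra

/-- Linear version of `bint`. -/
def bintL {ι : Type*} [DecidableEq ι] : List ι → (GA R ι →ₗ[R] GA R ι)
  | [] => LinearMap.id
  | i :: t => gaDeriv i ∘ₗ bintL t

theorem bint_eq {ι : Type*} [DecidableEq ι] (l : List ι) (f : GA R ι) :
    bint l f = bintL l f := by
  induction l with
  | nil => rfl
  | cons a t ih => simp [bint, bintL, ih]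

theorem bintL_append {ι : Type*} [DecidableEq ι] (l l' : List ι) (f : GA R ι) :
    bintL (l ++ l') f = bintL l (bintL l' f) := by
  induction l with
  | nil => rfl
  | cons a t ih => simp [bintL, ih]

theorem gaDeriv_ι_mul {ι : Type*} [DecidableEq ι] (i : ι) (u : ι → R) (f : GA R ι) :
    gaDeriv i (ExteriorAlgebra.ι R u * f) = u i • f - ExteriorAlgebra.ι R u * gaDeriv i f := by
  exact CliffordAlgebra.contractLeft_ι_mul (Q := (0 : QuadraticForm R (ι → R))) _ u f

theorem gaDeriv_algebraMap {ι : Type*} [DecidableEq ι] (i : ι) (r : R) :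
    gaDeriv i (algebraMap R (GA R ι) r) = 0 := by
  exact CliffordAlgebra.contractLeft_algebraMap (Q := (0 : QuadraticForm R (ι → R))) _ r

theorem gaDeriv_prod_zero {ι : Type*} [DecidableEq ι] (a : ι) (t : List ι) (h : a ∉ t) :
    gaDeriv a ((t.map (gaGen : ι → GA R ι)).prod) = 0 := by
  induction t with
  | nil => simpa using gaDeriv_algebraMap (R := R) a 1
  | cons b t ih =>
    simp only [List.mem_cons, not_or] at h
    rw [List.map_cons, List.prod_cons, gaGen, gaDeriv_ι_mul, ih h.2]
    simp [h.1]

theorem bintL_prod {ι : Type*} [DecidableEq ι] (l : List ι) (h : l.Nodup) :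
    bintL l.reverse ((l.map (gaGen : ι → GA R ι)).prod) = 1 := by
  induction l with
  | nil => simp [bintL]
  | cons a t ih =>
    rw [List.nodup_cons] at h
    rw [List.reverse_cons, bintL_append, List.map_cons, List.prod_cons]
    simp only [bintL, LinearMap.comp_apply, LinearMap.id_apply]
    rw [gaGen, gaDeriv_ι_mul, gaDeriv_prod_zero a t h.1]
    simpa using ih h.2

/-- The Berezin integral. -/
def bz (n : ℕ) : GA R (Fin n) →ₗ[R] R :=
  gaCoef.toLinearMap ∘ₗ bintL (List.ofFn (id : Fin n → Fin n)).reverse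

theorem bz_multi (n : ℕ) (v : Fin n → Fin n → R) :
    bz n (ιMulti R n v) = (Matrix.of v).det := by
  have h := AlternatingMap.eq_smul_basis_det (Pi.basisFun R (Fin n))
    ((bz (R := R) n).compAlternatingMap (ιMulti R n))
  have h1 : (bz (R := R) n).compAlternatingMap (ιMulti R n) (Pi.basisFun R (Fin n)) = 1 := by
    rw [LinearMap.compAlternatingMap_apply, ιMulti_apply]
    have := bintL_prod (R := R) (List.ofFn (id : Fin n → Fin n)) (List.nodup_ofFn.2 Function.injective_id)
    rw [List.map_ofFn] at this
    have h2 : (List.ofFn fun i => ExteriorAlgebra.ι R (Pi.basisFun R (Fin n) i)) =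
      List.ofFn ((gaGen : Fin n → GA R (Fin n)) ∘ id) := by
      congr 1; ext i; simp [gaGen]
    rw [h2, bz, LinearMap.comp_apply, this]
    simp
  rw [h1, one_smul] at h
  have := congrArg (fun f => f v) h
  simp only [LinearMap.compAlternatingMap_apply] at this
  rw [this, Pi.basisFun_det]
  rfl

/-- degree `k` part -/
abbrev Mk (R : Type*) [CommRing R] (ι : Type*) (k : ℕ) : Submodule R (GA R ι) :=
  (LinearMap.range (ExteriorAlgebra.ι R : (ι → R) →ₗ[R] GA R ι)) ^ k

theorem gaDeriv_Mk_zero {ι : Type*} [DecidableEq ι] (i : ι) (f : GA R ι) (hf : f ∈ Mk R ι 0) :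
    gaDeriv i f = 0 := by
  rw [Mk, pow_zero, Submodule.mem_one] at hf
  obtain ⟨r, rfl⟩ := hf
  exact gaDeriv_algebraMap i r

theorem gaDeriv_Mk_succ {ι : Type*} [DecidableEq ι] (i : ι) (k : ℕ) (f : GA R ι)
    (hf : f ∈ Mk R ι (k + 1)) : gaDeriv i f ∈ Mk R ι k := by
  induction k generalizing f with
  | zero =>
    rw [Mk, zero_add, pow_one] at hf
    obtain ⟨u, rfl⟩ := hf
    have := gaDeriv_ι_mul i u (1 : GA R ι)
    rw [gaDeriv_Mk_zero i 1 (by simp [Mk])] at this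
    rw [mul_one] at this
    rw [this]
    simp only [Mk, pow_zero, mul_zero, sub_zero]
    exact Submodule.smul_mem _ _ (by simp)
  | succ k ih =>
    rw [Mk, pow_succ'] at hf
    induction hf using Submodule.mul_induction_on' with
    | mem_mul_mem a ha b hb =>
      obtain ⟨u, rfl⟩ := ha
      rw [gaDeriv_ι_mul]
      refine Submodule.sub_mem _ (Submodule.smul_mem _ _ hb) ?_
      rw [Mk, pow_succ']
      exact Submodule.mul_mem_mul ⟨u, rfl⟩ (ih b hb)
    | add a _ b _ ha hb => rw [map_add]; exact Submodule.add_mem _ ha hb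

theorem bintL_Mk {ι : Type*} [DecidableEq ι] (l : List ι) (k : ℕ) (f : GA R ι)
    (hf : f ∈ Mk R ι k) : (k < l.length → bintL l f = 0) ∧
      (l.length ≤ k → bintL l f ∈ Mk R ι (k - l.length)) := by
  induction l with
  | nil => simpa [bintL] using hf
  | cons a t ih =>
    simp only [List.length_cons, bintL, LinearMap.comp_apply]
    refine ⟨fun h => ?_, fun h => ?_⟩
    · rcases Nat.lt_or_ge k t.length with h' | h'
      · rw [ih.1 h', map_zero]
      · have := ih.2 h'
        rw [show k - t.length = 0 by omega] at this
        exact gaDeriv_Mk_zero _ _ this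
    · have := ih.2 (by omega)
      apply gaDeriv_Mk_succ
      rwa [show k - (t.length + 1) + 1 = k - t.length by omega]

theorem gaCoef_Mk {ι : Type*} (k : ℕ) (f : GA R ι) (hf : f ∈ Mk R ι (k + 1)) :
    gaCoef f = 0 := by
  rw [Mk, pow_succ'] at hf
  induction hf using Submodule.mul_induction_on' with
  | mem_mul_mem a ha b hb =>
    obtain ⟨u, rfl⟩ := ha
    rw [map_mul]
    simp [gaCoef, algebraMapInv]
  | add a _ b _ ha hb => rw [map_add, ha, hb, add_zero]

theorem bz_Mk {n k : ℕ} (f : GA R (Fin n)) (hf : f ∈ Mk R (Fin n) k) (h : k ≠ n) :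
    bz n f = 0 := by
  have := bintL_Mk (List.ofFn (id : Fin n → Fin n)).reverse k f hf
  simp only [List.length_reverse, List.length_ofFn] at this
  rw [bz, LinearMap.comp_apply]
  rcases Nat.lt_or_ge k n with h' | h'
  · rw [this.1 h', map_zero]
  · have h2 := this.2 h'
    obtain ⟨j, hj⟩ : ∃ j, k - n = j + 1 := ⟨k - n - 1, by omega⟩
    rw [hj] at h2
    exact gaCoef_Mk _ _ h2

theorem bz_gexp (m : ℕ) (i : Fin (2 * m + 1)) (f : GA R (Fin (2 * m + 1)))
    (hf : f ∈ Mk R (Fin (2 * m + 1)) 2) :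
    gaCoef (bint ((List.ofFn (id : Fin (2 * m + 1) → Fin (2 * m + 1))).reverse)
        ((gaGen i : GA R (Fin (2 * m + 1))) * gexp f)) =
      algebraMap ℚ R (m.factorial : ℚ)⁻¹ * bz (2 * m + 1) (gaGen i * f ^ m) := by
  rw [bint_eq]
  change bz (2 * m + 1) _ = _
  rw [gexp, Finset.mul_sum, map_sum, Finset.sum_eq_single m]
  · rw [mul_smul_comm, map_smul, smul_eq_mul]
  · intro p _ hp
    rw [mul_smul_comm, map_smul, bz_Mk (k := 1 + 2 * p), smul_zero]
    · rw [Mk, pow_add, pow_one, pow_mul]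
      exact Submodule.mul_mem_mul ⟨_, rfl⟩ (Submodule.pow_mem_pow _ hf _)
    · omega
  · intro h; simp at h; omega

theorem ιι_center {ι : Type*} (u v : ι → R) :
    ExteriorAlgebra.ι R u * ExteriorAlgebra.ι R v ∈ Subalgebra.center R (GA R ι) := by
  rw [Subalgebra.mem_center_iff]
  intro b
  induction b using ExteriorAlgebra.induction with
  | algebraMap r => exact Algebra.commutes _ _
  | ι w =>
    have h1 := eq_neg_of_add_eq_zero_left (ι_add_mul_swap (R := R) w u)
    have h2 := eq_neg_of_add_eq_zero_left (ι_add_mul_swap (R := R) w v)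
    rw [← mul_assoc, h1, neg_mul, mul_assoc, h2, mul_neg, neg_neg, mul_assoc]
  | mul a b ha hb => rw [mul_assoc, hb, ← mul_assoc, ha, mul_assoc]
  | add a b ha hb => rw [add_mul, mul_add, ha, hb]

/-- the central element `u ∧ v` -/
def zc {ι : Type*} (u v : ι → R) : Subalgebra.center R (GA R ι) := ⟨_, ιι_center u v⟩

/-- rows -/
def rows {N : ℕ} (m : ℕ) (u : Fin N → R) (p q : Fin m → Fin N → R) :
    Fin (2 * m + 1) → Fin N → R :=
  Fin.cons u (fun s : Fin (2 * m) => if (s : ℕ) % 2 = 0 then p ⟨s / 2, by omega⟩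
    else q ⟨s / 2, by omega⟩)

theorem bz_prod (m : ℕ) (u : Fin (2 * m + 1) → R) (p q : Fin m → Fin (2 * m + 1) → R) :
    bz (2 * m + 1) (ExteriorAlgebra.ι R u *
      ((∏ t, zc (p t) (q t) : Subalgebra.center R (GA R (Fin (2 * m + 1)))) :
        GA R (Fin (2 * m + 1)))) = (Matrix.of (rows m u p q)).det := by
  rw [← bz_multi, ιMulti_apply, List.ofFn_succ, List.prod_cons]
  congr 2
  simp only [rows, Fin.cons_succ]
  rw [List.ofFn_mul', List.prod_flatten, List.map_ofFn, ← List.prod_ofFn]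
  change (Subalgebra.center R (GA R (Fin (2 * m + 1)))).val _ = _
  rw [map_list_prod, List.map_ofFn]
  congr 2
  ext t
  simp only [Function.comp_apply, List.ofFn_succ, List.ofFn_zero]
  have : (2 * (t : ℕ) + 1) / 2 = t := by omega
  simp [zc, Nat.add_mod, this]

theorem det_zero_of_mulVec {n : ℕ} (M : Matrix (Fin n) (Fin n) R) (v : Fin n → R)
    (h : M.mulVec v = 0) (j : Fin n) (hj : v j = 1) : M.det = 0 := by
  have h1 : (M.adjugate * M).mulVec v = 0 := by rw [← Matrix.mulVec_mulVec, h, Matrix.mulVec_zero]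
  rw [Matrix.adjugate_mul, Matrix.smul_mulVec, Matrix.one_mulVec] at h1
  simpa [hj] using congrFun h1 j

theorem bz_zero (m : ℕ) (u : Fin (2 * m + 1) → R) (p q : Fin m → Fin (2 * m + 1) → R)
    (v : Fin (2 * m + 1) → R) (j) (hj : v j = 1) (hu : u ⬝ᵥ v = 0) (hp : ∀ t, p t ⬝ᵥ v = 0)
    (hq : ∀ t, q t ⬝ᵥ v = 0) :
    bz (2 * m + 1) (ExteriorAlgebra.ι R u *
      ((∏ t, zc (p t) (q t) : Subalgebra.center R (GA R (Fin (2 * m + 1)))) :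
        GA R (Fin (2 * m + 1)))) = 0 := by
  rw [bz_prod]
  refine det_zero_of_mulVec _ v ?_ j hj
  ext s
  change rows m u p q s ⬝ᵥ v = 0
  refine Fin.cases ?_ (fun s => ?_) s
  · simpa [rows] using hu
  · simp only [rows, Fin.cons_succ]
    split_ifs
    · exact hp _
    · exact hq _

theorem sum_pow_sq_zero {S : Type*} [CommRing S] {α : Type*} [DecidableEq α] (s : Finset α)
    (w : α → S) (hw : ∀ a ∈ s, w a ^ 2 = 0) (m : ℕ) :
    (∑ a ∈ s, w a) ^ m = (m.factorial : S) * ∑ t ∈ s.powersetCard m, ∏ a ∈ t, w a := by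
  induction s using Finset.induction_on generalizing m with
  | empty =>
    cases m with
    | zero => simp
    | succ m => rw [Finset.powersetCard_eq_empty.2 (by simp)]; simp
  | insert a s ha ih =>
    cases m with
    | zero => simp
    | succ m =>
      have ih := ih (fun b hb => hw b (Finset.mem_insert_of_mem hb))
      have h2 := hw a (Finset.mem_insert_self _ _)
      rw [Finset.sum_insert ha, Finset.powersetCard_succ_insert ha, Finset.sum_union,
        Finset.sum_image]
      · have : ∀ t ∈ s.powersetCard m, ∏ b ∈ insert a t, w b = w a * ∏ b ∈ t, w b := by
          intro t ht
          rw [Finset.prod_insert]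
          exact fun h => ha ((Finset.mem_powersetCard.1 ht).1 h)
        rw [Finset.sum_congr rfl this, ← Finset.mul_sum, mul_add, ← ih]
        have e : (w a + ∑ b ∈ s, w b) ^ (m + 1) =
            (∑ b ∈ s, w b) ^ (m + 1) + (m + 1 : ℕ) * w a * (∑ b ∈ s, w b) ^ m := by
          clear ih this
          generalize (∑ b ∈ s, w b) = X
          induction m with
          | zero => simp; ring
          | succ m ihm =>
            rw [pow_succ, ihm]
            push_cast
            linear_combination (m + 1) * X ^ m * h2
        rw [e, Nat.factorial_succ]
        rw [show (((m + 1) * m.factorial : ℕ) : S) * (w a * ∑ t ∈ s.powersetCard m, ∏ b ∈ t, w b)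
          = (m + 1 : ℕ) * w a * ((m.factorial : S) * ∑ t ∈ s.powersetCard m, ∏ b ∈ t, w b) by
            push_cast; ring, ← ih]
      · intro t ht t' ht' h
        have h1 : a ∉ t := fun h => ha ((Finset.mem_powersetCard.1 ht).1 h)
        have h1' : a ∉ t' := fun h => ha ((Finset.mem_powersetCard.1 ht').1 h)
        rw [← Finset.erase_insert h1, ← Finset.erase_insert h1', h]
      · rw [Finset.disjoint_left]
        intro t ht ht'
        obtain ⟨t', -, rfl⟩ := Finset.mem_image.1 ht'
        exact ha ((Finset.mem_powersetCard.1 ht).1 (Finset.mem_insert_self _ _))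

/-- basis vector -/
abbrev ev {N : ℕ} (i : Fin N) : Fin N → R := Pi.single i 1

theorem gaGen_mul {N : ℕ} (b c : Fin N) :
    (gaGen b * gaGen c : GA R (Fin N)) = (zc (ev b) (ev c) : Subalgebra.center R (GA R (Fin N))) := rfl

/-- index list -/
def idx {N : ℕ} (m : ℕ) (i : Fin N) (p q : Fin m → Fin N) : Fin (2 * m + 1) → Fin N :=
  Fin.cons i (fun s : Fin (2 * m) => if (s : ℕ) % 2 = 0 then p ⟨s / 2, by omega⟩
    else q ⟨s / 2, by omega⟩)

theorem rows_ev {N : ℕ} (m : ℕ) (i : Fin N) (p q : Fin m → Fin N) :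
    rows (R := R) m (ev i) (fun t => ev (p t)) (fun t => ev (q t)) = fun s => ev (idx m i p q s) := by
  ext s
  refine Fin.cases ?_ (fun s => ?_) s
  · simp [rows, idx]
  · simp only [rows, idx, Fin.cons_succ]
    split_ifs <;> rfl

theorem det_perm_row {k : ℕ} (i : Fin (k + 1)) (σ : Equiv.Perm (Fin k)) :
    (Matrix.of (fun s => (ev ((Fin.cons i (fun t => i.succAbove (σ t)) : Fin (k + 1) → Fin (k + 1)) s) :
      Fin (k + 1) → R))).det = (-1) ^ (i : ℕ) * ((Equiv.Perm.sign σ : ℤ) : R) := by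
  rw [Matrix.det_succ_row_zero, Finset.sum_eq_single i]
  · have : (Matrix.of (fun s => (ev ((Fin.cons i (fun t => i.succAbove (σ t)) : Fin (k + 1) → Fin (k + 1)) s) :
      Fin (k + 1) → R))).submatrix Fin.succ i.succAbove = (1 : Matrix (Fin k) (Fin k) R).submatrix σ id := by
      ext s t
      simp [Matrix.one_apply, Pi.single_apply, eq_comm]
    rw [this, Matrix.det_permute]
    simp
  · intro j _ hj
    simp [hj]
  · simp

theorem pf_side (m : ℕ) (A : Fin (2 * m + 1) → Fin (2 * m + 1) → R) (i : Fin (2 * m + 1)) :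
    algebraMap ℚ R (m.factorial : ℚ)⁻¹ * bz (2 * m + 1) (gaGen i *
      (algebraMap ℚ R (1 / 2 : ℚ) • ∑ b, ∑ c, A b c • (gaGen b * gaGen c)) ^ m) =
    (-1) ^ (i : ℕ) * pf (fun s t : Fin (2 * m) => A (i.succAbove s) (i.succAbove t)) := by
  have h1 : (∑ b, ∑ c, A b c • (gaGen b * gaGen c) : GA R (Fin (2 * m + 1))) =
      ((∑ x : Fin (2 * m + 1) × Fin (2 * m + 1), A x.1 x.2 • zc (ev x.1) (ev x.2) :
        Subalgebra.center R (GA R (Fin (2 * m + 1)))) : GA R (Fin (2 * m + 1))) := by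
    rw [Fintype.sum_prod_type]
    push_cast
    rfl
  rw [smul_pow, h1, ← SubmonoidClass.coe_pow, Fintype.sum_pow, mul_smul_comm, map_smul,
    smul_eq_mul, AddSubmonoidClass.coe_finsetSum, Finset.mul_sum, map_sum]
  unfold pf
  have h2 : ∀ g : Fin m → Fin (2 * m + 1) × Fin (2 * m + 1),
      bz (2 * m + 1) (gaGen i * ((∏ t, A (g t).1 (g t).2 • zc (ev (g t).1) (ev (g t).2) :
        Subalgebra.center R (GA R (Fin (2 * m + 1)))) : GA R (Fin (2 * m + 1)))) =
      (∏ t, A (g t).1 (g t).2) * (Matrix.of (fun s => (ev (idx m i (fun t => (g t).1)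
        (fun t => (g t).2) s) : Fin (2 * m + 1) → R))).det := by
    intro g
    rw [Finset.prod_smul, SetLike.val_smul, mul_smul_comm, map_smul, smul_eq_mul, ← rows_ev,
      ← bz_prod]
    rfl
  rw [Finset.sum_congr rfl (fun g _ => h2 g)]
  have h3 : ∑ σ : Equiv.Perm (Fin (2 * m)), (-1) ^ (i : ℕ) * ((Equiv.Perm.sign σ : ℤ) •
      ∏ j : Fin m, A (i.succAbove (σ ⟨2 * (j : ℕ), by omega⟩))
        (i.succAbove (σ ⟨2 * (j : ℕ) + 1, by omega⟩))) =
    ∑ g : Fin m → Fin (2 * m + 1) × Fin (2 * m + 1), (∏ t, A (g t).1 (g t).2) *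
      (Matrix.of (fun s => (ev (idx m i (fun t => (g t).1)
        (fun t => (g t).2) s) : Fin (2 * m + 1) → R))).det := by
    have key : ∀ (σ : Fin (2 * m) → Fin (2 * m)), (idx m i
        (fun t : Fin m => i.succAbove (σ ⟨2 * (t : ℕ), by omega⟩))
        (fun t : Fin m => i.succAbove (σ ⟨2 * (t : ℕ) + 1, by omega⟩))) =
        Fin.cons i (fun t => i.succAbove (σ t)) := by
      intro σ
      unfold idx
      congr 1
      funext s
      split_ifs with h
      · exact congrArg (fun z => i.succAbove (σ z)) (Fin.ext (by simp; omega))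
      · exact congrArg (fun z => i.succAbove (σ z)) (Fin.ext (by simp; omega))
    apply Fintype.sum_of_injective (fun (σ : Equiv.Perm (Fin (2 * m))) (t : Fin m) =>
      (i.succAbove (σ ⟨2 * (t : ℕ), by omega⟩), i.succAbove (σ ⟨2 * (t : ℕ) + 1, by omega⟩)))
    · intro σ τ h
      ext s
      congr 1
      have h := congrFun h ⟨s / 2, by omega⟩
      simp only [Prod.mk.injEq, Fin.succAbove_right_inj] at h
      rcases Nat.mod_two_eq_zero_or_one s with hs | hs
      · convert h.1 using 2 <;> (apply Fin.ext; simp; omega)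
      · convert h.2 using 2 <;> (apply Fin.ext; simp; omega)
    · intro g hg
      by_cases hP : Function.Injective (idx m i (fun t => (g t).1) (fun t => (g t).2))
      · exfalso
        apply hg
        have h0 : ∀ s : Fin (2 * m), ∃ z, i.succAbove z =
            idx m i (fun t => (g t).1) (fun t => (g t).2) s.succ := by
          intro s
          apply Fin.exists_succAbove_eq
          intro h
          have : idx m i (fun t => (g t).1) (fun t => (g t).2) s.succ =
            idx m i (fun t => (g t).1) (fun t => (g t).2) 0 := by rw [h]; simp [idx]
          exact absurd (hP this) (Fin.succ_ne_zero s)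
        choose σ hσ using h0
        have hinj : Function.Injective σ := by
          intro s t hst
          have : i.succAbove (σ s) = i.succAbove (σ t) := by rw [hst]
          rw [hσ, hσ] at this
          exact Fin.succ_injective _ (hP this)
        refine ⟨Equiv.ofBijective σ (Finite.injective_iff_bijective.1 hinj), ?_⟩
        ext1 t
        have a1 := hσ ⟨2 * (t : ℕ), by omega⟩
        have a2 := hσ ⟨2 * (t : ℕ) + 1, by omega⟩
        have e : (2 * (t : ℕ) + 1) / 2 = t := by omega
        simp only [idx, Fin.cons_succ] at a1 a2
        simp [Nat.add_mod, e] at a1 a2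
        ext1 <;> simp [a1, a2]
      · rw [Function.Injective] at hP
        push Not at hP
        obtain ⟨s, t, hst, hne⟩ := hP
        rw [Matrix.det_zero_of_row_eq hne, mul_zero]
        ext z
        simp [hst]
    · intro σ
      dsimp only
      rw [key σ, det_perm_row, zsmul_eq_mul]
      ring
  rw [← h3, ← Finset.mul_sum]
  have h4 : algebraMap ℚ R (m.factorial : ℚ)⁻¹ * algebraMap ℚ R (1 / 2 : ℚ) ^ m =
      algebraMap ℚ R ((2 ^ m * m.factorial : ℚ))⁻¹ := by
    rw [← map_pow, ← map_mul]
    congr 1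
    rw [mul_inv, one_div, inv_pow, mul_comm]
  rw [← h4]
  ring

theorem orderIso_eq (n : ℕ) (i : Fin (n + 1)) (h : ({i}ᶜ : Finset (Fin (n + 1))).card = n) (s : Fin n) :
    ((({i}ᶜ : Finset (Fin (n + 1))).orderIsoOfFin h s : _) : Fin (n + 1)) = i.succAbove s := by
  rw [Finset.coe_orderIsoOfFin_apply]
  rw [← Finset.orderEmbOfFin_unique h (f := i.succAbove) (by simp) (Fin.strictMono_succAbove i)]

section W
variable {N : ℕ} (y : Fin N → Fin N → Fin N → R)

/-- elementary term -/
def TT (a b c : Fin N) : Subalgebra.center R (GA R (Fin N)) :=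
  y a b c • zc (ev b - ev a) (ev c - ev a)

theorem ι_swap {ι : Type*} (u v : ι → R) :
    (ExteriorAlgebra.ι R u * ExteriorAlgebra.ι R v : GA R ι) =
      -(ExteriorAlgebra.ι R v * ExteriorAlgebra.ι R u) :=
  eq_neg_of_add_eq_zero_left (ι_add_mul_swap (R := R) u v)

theorem TT_swap1 (hy1 : ∀ a b c, y b a c = -y a b c) (a b c : Fin N) :
    TT y b a c = TT y a b c := by
  apply Subtype.ext
  simp only [TT, hy1 a b c, SetLike.val_smul, zc, map_sub, sub_mul, mul_sub, ι_sq_zero]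
  rw [ι_swap (ev b) (ev a)]
  module

theorem TT_swap2 (hy2 : ∀ a b c, y a c b = -y a b c) (a b c : Fin N) :
    TT y a c b = TT y a b c := by
  apply Subtype.ext
  simp only [TT, hy2 a b c, SetLike.val_smul, zc]
  rw [ι_swap (ev b - ev a)]
  module

/-- block weight -/
def WW (B : Finset (Fin N)) : Subalgebra.center R (GA R (Fin N)) :=
  algebraMap ℚ R (1 / 6 : ℚ) • ∑ x : Fin N × Fin N × Fin N with ({x.1, x.2.1, x.2.2} : Finset (Fin N)) = B,
    TT y x.1 x.2.1 x.2.2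

theorem WW_eq (hy1 : ∀ a b c, y b a c = -y a b c) (hy2 : ∀ a b c, y a c b = -y a b c)
    (a b c : Fin N) (hab : a ≠ b) (hac : a ≠ c) (hbc : b ≠ c) :
    WW y {a, b, c} = TT y a b c := by
  have h : (Finset.univ.filter (fun x : Fin N × Fin N × Fin N =>
      ({x.1, x.2.1, x.2.2} : Finset (Fin N)) = {a, b, c})) =
      {(a, b, c), (a, c, b), (b, a, c), (b, c, a), (c, a, b), (c, b, a)} := by
    ext ⟨x, z, w⟩
    simp only [Finset.mem_filter, Finset.mem_univ, true_and, Finset.mem_insert,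
      Finset.mem_singleton, Prod.mk.injEq]
    constructor
    · intro h
      have h1 : x ∈ ({a, b, c} : Finset (Fin N)) := by rw [← h]; simp
      have h2 : z ∈ ({a, b, c} : Finset (Fin N)) := by rw [← h]; simp
      have h3 : w ∈ ({a, b, c} : Finset (Fin N)) := by rw [← h]; simp
      have h4 : a ∈ ({x, z, w} : Finset (Fin N)) := by rw [h]; simp
      have h5 : b ∈ ({x, z, w} : Finset (Fin N)) := by rw [h]; simp
      have h6 : c ∈ ({x, z, w} : Finset (Fin N)) := by rw [h]; simp
      simp only [Finset.mem_insert, Finset.mem_singleton] at h1 h2 h3 h4 h5 h6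
      clear h hy1 hy2
      grind
    · rintro (⟨rfl, rfl, rfl⟩ | ⟨rfl, rfl, rfl⟩ | ⟨rfl, rfl, rfl⟩ | ⟨rfl, rfl, rfl⟩ |
        ⟨rfl, rfl, rfl⟩ | ⟨rfl, rfl, rfl⟩) <;> (ext v; simp only [Finset.mem_insert, Finset.mem_singleton]; try tauto)
  rw [WW, h]
  have s1 := TT_swap1 y hy1
  have s2 := TT_swap2 y hy2
  rw [Finset.sum_insert, Finset.sum_insert, Finset.sum_insert, Finset.sum_insert,
    Finset.sum_insert, Finset.sum_singleton]
  · dsimp only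
    rw [s2 a b c, s1 a b c, s2 b a c, s1 a b c, s1 a c b, s2 a b c, s2 c a b, s1 a c b, s2 a b c]
    have : (algebraMap ℚ R (1 / 6 : ℚ)) * 6 = 1 := by
      rw [show (6 : R) = algebraMap ℚ R 6 from (map_ofNat (algebraMap ℚ R) 6).symm, ← map_mul]; norm_num
    calc _ = ((algebraMap ℚ R (1 / 6 : ℚ)) * 6) • TT y a b c := by module
      _ = _ := by rw [this, one_smul]
  all_goals
    simp only [Finset.mem_insert, Finset.mem_singleton, Prod.mk.injEq]
    clear h s1 s2 hy1 hy2
    grind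

theorem zc_sq {ι : Type*} (u v : ι → R) : (zc u v) ^ 2 = 0 := by
  apply Subtype.ext
  rw [sq]
  change (ExteriorAlgebra.ι R u * ExteriorAlgebra.ι R v) * (ExteriorAlgebra.ι R u * ExteriorAlgebra.ι R v) = (0 : GA R ι)
  rw [mul_assoc, ← mul_assoc (ExteriorAlgebra.ι R v), ι_swap v u, neg_mul, mul_assoc, ι_sq_zero]
  simp

theorem WW_sq (hy1 : ∀ a b c, y b a c = -y a b c) (hy2 : ∀ a b c, y a c b = -y a b c)
    (B : Finset (Fin N)) (hB : B.card = 3) : WW y B ^ 2 = 0 := by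
  obtain ⟨a, b, c, hab, hac, hbc, rfl⟩ := Finset.card_eq_three.1 hB
  rw [WW_eq y hy1 hy2 a b c hab hac hbc, TT, smul_pow, zc_sq, smul_zero]

theorem self_neg (r : R) (h : r = -r) : r = 0 := by
  have h2 : (algebraMap ℚ R (1 / 2 : ℚ)) * 2 = 1 := by
    rw [show (2 : R) = algebraMap ℚ R 2 from (map_ofNat (algebraMap ℚ R) 2).symm, ← map_mul]; norm_num
  linear_combination algebraMap ℚ R (1 / 2 : ℚ) * h - r * h2

theorem WW_zero (hy1 : ∀ a b c, y b a c = -y a b c) (hy2 : ∀ a b c, y a c b = -y a b c)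
    (B : Finset (Fin N)) (hB : B.card ≠ 3) : WW y B = 0 := by
  rw [WW, Finset.sum_eq_zero, smul_zero]
  rintro ⟨a, b, c⟩ h
  simp only [Finset.mem_filter, Finset.mem_univ, true_and] at h
  subst h
  have : y a b c = 0 := by
    by_cases hab : a = b
    · subst hab; exact self_neg _ (hy1 a a c)
    by_cases hbc : b = c
    · subst hbc; exact self_neg _ (hy2 a b b)
    by_cases hac : a = c
    · subst hac; apply self_neg
      conv_lhs => rw [hy1, hy2, hy1]
      simp
    exact absurd (Finset.card_eq_three.2 ⟨a, b, c, hab, hac, hbc, rfl⟩) hB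
  simp [TT, this]

theorem f_eq (hy1 : ∀ a b c, y b a c = -y a b c) (hy2 : ∀ a b c, y a c b = -y a b c) :
    (algebraMap ℚ R (1 / 2 : ℚ) • ((∑ a, ∑ b, ∑ c, y a b c • (gaGen b * gaGen c)) : GA R (Fin N))) =
    ((∑ B ∈ Finset.univ.powersetCard 3, WW y B : Subalgebra.center R (GA R (Fin N))) : GA R (Fin N)) := by
  have h1 : ∑ B ∈ Finset.univ.powersetCard 3, WW y B = ∑ B, WW y B := by
    apply Finset.sum_subset (Finset.subset_univ _)
    intro B _ hB
    apply WW_zero y hy1 hy2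
    simpa [Finset.mem_powersetCard] using hB
  rw [h1]
  unfold WW
  rw [← Finset.smul_sum, Finset.sum_fiberwise, Fintype.sum_prod_type, SetLike.val_smul,
    AddSubmonoidClass.coe_finsetSum]
  simp_rw [Fintype.sum_prod_type, AddSubmonoidClass.coe_finsetSum]
  have h2 : ∀ a b c, ((TT y a b c : Subalgebra.center R (GA R (Fin N))) : GA R (Fin N)) =
      y a b c • (gaGen b * gaGen c) - y a b c • (gaGen b * gaGen a) -
        y a b c • (gaGen a * gaGen c) := by
    intro a b c
    simp only [TT, SetLike.val_smul, zc, map_sub, sub_mul, mul_sub, ι_sq_zero, gaGen]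
    module
  simp_rw [h2, Finset.sum_sub_distrib]
  have e1 : ∑ a, ∑ b, ∑ c, y a b c • (gaGen a * gaGen c : GA R (Fin N)) =
      -∑ a, ∑ b, ∑ c, y a b c • (gaGen b * gaGen c : GA R (Fin N)) := by
    rw [Finset.sum_comm]
    simp_rw [← Finset.sum_neg_distrib]
    refine Finset.sum_congr rfl fun a _ => Finset.sum_congr rfl fun b _ =>
      Finset.sum_congr rfl fun c _ => ?_
    rw [hy1, neg_smul]
  have e2 : ∑ a, ∑ b, ∑ c, y a b c • (gaGen b * gaGen a : GA R (Fin N)) =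
      -∑ a, ∑ b, ∑ c, y a b c • (gaGen b * gaGen c : GA R (Fin N)) := by
    have : ∑ a, ∑ b, ∑ c, y a b c • (gaGen b * gaGen a : GA R (Fin N)) =
        ∑ c, ∑ b, ∑ a, y a b c • (gaGen b * gaGen a : GA R (Fin N)) := by
      rw [Finset.sum_comm]
      rw [Finset.sum_comm (s := Finset.univ) (t := Finset.univ) (f := fun c b => ∑ a, y a b c • (gaGen b * gaGen a : GA R (Fin N)))]
      exact Finset.sum_congr rfl fun b _ => Finset.sum_comm
    rw [this]
    simp_rw [← Finset.sum_neg_distrib]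
    refine Finset.sum_congr rfl fun a _ => Finset.sum_congr rfl fun b _ =>
      Finset.sum_congr rfl fun c _ => ?_
    rw [hy1 b c a, hy2 b a c, hy1 a b c]
    simp
  rw [e1, e2]
  have : (algebraMap ℚ R (1 / 2 : ℚ)) = algebraMap ℚ R (1 / 6 : ℚ) * 3 := by
    rw [show (3 : R) = algebraMap ℚ R 3 from (map_ofNat (algebraMap ℚ R) 3).symm, ← map_mul]; norm_num
  rw [this]
  module

end W

theorem cactus_side (m : ℕ) (y : Fin (2 * m + 1) → Fin (2 * m + 1) → Fin (2 * m + 1) → R)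
    (hy1 : ∀ a b c, y b a c = -y a b c) (hy2 : ∀ a b c, y a c b = -y a b c)
    (i : Fin (2 * m + 1)) :
    algebraMap ℚ R (m.factorial : ℚ)⁻¹ * bz (2 * m + 1) (gaGen i *
      (algebraMap ℚ R (1 / 2 : ℚ) • ((∑ a, ∑ b, ∑ c, y a b c • (gaGen b * gaGen c)) :
        GA R (Fin (2 * m + 1)))) ^ m) =
    ∑ 𝒜 ∈ ((Finset.univ : Finset (Fin (2 * m + 1))).powersetCard 3).powersetCard m,
      bz (2 * m + 1) (gaGen i * ((∏ B ∈ 𝒜, WW y B :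
        Subalgebra.center R (GA R (Fin (2 * m + 1)))) : GA R (Fin (2 * m + 1)))) := by
  rw [f_eq y hy1 hy2, ← SubmonoidClass.coe_pow, sum_pow_sq_zero _ _ (fun B hB => WW_sq y hy1 hy2 B
    (Finset.mem_powersetCard.1 hB).2), ← nsmul_eq_mul]
  rw [← map_sum, ← Finset.mul_sum, ← AddSubmonoidClass.coe_finsetSum]
  rw [← Nat.cast_smul_eq_nsmul R, SetLike.val_smul, mul_smul_comm, map_smul, smul_eq_mul,
    ← mul_assoc]
  have : algebraMap ℚ R (m.factorial : ℚ)⁻¹ * (m.factorial : R) = 1 := by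
    rw [show (m.factorial : R) = algebraMap ℚ R m.factorial by simp, ← map_mul,
      inv_mul_cancel₀ (by positivity), map_one]
  rw [this, one_mul]

section G
variable {n : ℕ} (𝒜 : Finset (Finset (Fin n)))

theorem adj_lr (A : {A // A ∈ 𝒜}) (j : Fin n) :
    (incGraph 𝒜).Adj (Sum.inl A) (Sum.inr j) ↔ j ∈ A.1 := by
  simp [incGraph, SimpleGraph.fromRel_adj]

theorem not_adj_ll (A B : {A // A ∈ 𝒜}) : ¬ (incGraph 𝒜).Adj (Sum.inl A) (Sum.inl B) := by
  simp [incGraph, SimpleGraph.fromRel_adj]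

theorem not_adj_rr (i j : Fin n) : ¬ (incGraph 𝒜).Adj (Sum.inr i) (Sum.inr j) := by
  simp [incGraph, SimpleGraph.fromRel_adj]

theorem closer {V : Type*} (G : SimpleGraph V) (h : G.Connected) (u v : V) (huv : u ≠ v) :
    ∃ w, G.Adj u w ∧ G.dist w v < G.dist u v := by
  obtain ⟨p, hp⟩ := (h u v).exists_walk_length_eq_dist
  cases p with
  | nil => exact absurd rfl huv
  | cons hadj q =>
    refine ⟨_, hadj, ?_⟩
    rw [← hp, SimpleGraph.Walk.length_cons]
    exact Nat.lt_succ_of_le (SimpleGraph.dist_le q)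

theorem closer_block (h : (incGraph 𝒜).Connected) (v i : Fin n) (hv : v ≠ i) :
    ∃ (A : Finset (Fin n)) (hA : A ∈ 𝒜), v ∈ A ∧
      (incGraph 𝒜).dist (Sum.inl ⟨A, hA⟩) (Sum.inr i) < (incGraph 𝒜).dist (Sum.inr v) (Sum.inr i) := by
  obtain ⟨w, hw, hd⟩ := closer _ h (Sum.inr v) (Sum.inr i) (by simpa using hv)
  rcases w with A | j
  · exact ⟨A.1, A.2, (adj_lr 𝒜 A v).1 hw.symm, hd⟩
  · exact absurd hw (not_adj_rr 𝒜 _ _)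

theorem closer_elt (h : (incGraph 𝒜).Connected) (i : Fin n) (A : {A // A ∈ 𝒜}) :
    ∃ r ∈ A.1, (incGraph 𝒜).dist (Sum.inr r) (Sum.inr i) < (incGraph 𝒜).dist (Sum.inl A) (Sum.inr i) := by
  obtain ⟨w, hw, hd⟩ := closer _ h (Sum.inl A) (Sum.inr i) (by simp)
  rcases w with B | j
  · exact absurd hw (not_adj_ll 𝒜 _ _)
  · exact ⟨j, (adj_lr 𝒜 A j).1 hw, hd⟩

theorem card_edges (h3 : ∀ A ∈ 𝒜, A.card = 3) : Nat.card (incGraph 𝒜).edgeSet = 3 * 𝒜.card := by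
  have hb : (incGraph 𝒜).IsBipartiteWith
      (((Finset.univ : Finset {A // A ∈ 𝒜}).map ⟨Sum.inl, Sum.inl_injective⟩ :
        Finset ({A // A ∈ 𝒜} ⊕ Fin n)) : Set _)
      (((Finset.univ : Finset (Fin n)).map ⟨Sum.inr, Sum.inr_injective⟩ :
        Finset ({A // A ∈ 𝒜} ⊕ Fin n)) : Set _) := by
    constructor
    · rw [Finset.disjoint_coe, Finset.disjoint_left]
      rintro (x | x) <;> simp
    · rintro (x | x) (z | z) h
      · exact absurd h (not_adj_ll 𝒜 _ _)
      · simp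
      · simp
      · exact absurd h (not_adj_rr 𝒜 _ _)
  have := SimpleGraph.isBipartiteWith_sum_degrees_eq_card_edges hb
  rw [Nat.card_eq_fintype_card, ← SimpleGraph.edgeFinset_card, ← this, Finset.sum_map]
  have hd : ∀ A : {A // A ∈ 𝒜}, (incGraph 𝒜).degree (Sum.inl A) = 3 := by
    intro A
    rw [← h3 A.1 A.2, ← Finset.card_map ⟨Sum.inr, Sum.inr_injective⟩ (s := A.1),
      ← SimpleGraph.card_neighborFinset_eq_degree]
    congr 1
    ext (x | x)
    · simp [not_adj_ll]
    · simp [adj_lr]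
  simp only [Function.Embedding.coeFn_mk, hd]
  simp [mul_comm]

theorem tree_iff {m : ℕ} (𝒜 : Finset (Finset (Fin (2 * m + 1)))) (h3 : ∀ A ∈ 𝒜, A.card = 3) :
    (incGraph 𝒜).IsTree ↔ (incGraph 𝒜).Connected ∧ 𝒜.card = m := by
  rw [SimpleGraph.isTree_iff_connected_and_card, card_edges 𝒜 h3]
  simp only [Nat.card_eq_fintype_card, Fintype.card_sum, Fintype.card_coe, Fintype.card_fin]
  refine and_congr_right fun _ => ?_
  omega
end G

theorem WW_prod (m : ℕ) (y : Fin (2 * m + 1) → Fin (2 * m + 1) → Fin (2 * m + 1) → R)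
    (hy1 : ∀ a b c, y b a c = -y a b c) (hy2 : ∀ a b c, y a c b = -y a b c)
    (𝒜 : Finset (Finset (Fin (2 * m + 1)))) (h3 : ∀ A ∈ 𝒜, A.card = 3) (hm : 𝒜.card = m) :
    ∃ (s : R) (p q : Fin m → Fin (2 * m + 1) → R),
      ∏ B ∈ 𝒜, WW y B = s • ∏ t, zc (p t) (q t) ∧
      ∀ v : Fin (2 * m + 1) → R, (∀ B ∈ 𝒜, ∀ x ∈ B, ∀ z ∈ B, v x = v z) →
        ∀ t, p t ⬝ᵥ v = 0 ∧ q t ⬝ᵥ v = 0 := by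
  have h : ∀ A : {A // A ∈ 𝒜}, ∃ a b c, a ≠ b ∧ a ≠ c ∧ b ≠ c ∧ A.1 = {a, b, c} :=
    fun A => Finset.card_eq_three.1 (h3 A.1 A.2)
  choose a b c hab hac hbc hA using h
  let e : Fin m ≃ {A // A ∈ 𝒜} := (Finset.equivFinOfCardEq hm).symm
  refine ⟨∏ t, y (a (e t)) (b (e t)) (c (e t)), fun t => ev (b (e t)) - ev (a (e t)),
    fun t => ev (c (e t)) - ev (a (e t)), ?_, ?_⟩
  · rw [← Finset.prod_coe_sort, ← Finset.prod_smul, ← e.prod_comp]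
    refine Finset.prod_congr rfl fun t _ => ?_
    rw [hA, WW_eq y hy1 hy2 _ _ _ (hab _) (hac _) (hbc _)]
    rfl
  · intro v hv t
    have h1 := hv _ (e t).2 (b (e t)) (by rw [hA]; simp) (a (e t)) (by rw [hA]; simp)
    have h2 := hv _ (e t).2 (c (e t)) (by rw [hA]; simp) (a (e t)) (by rw [hA]; simp)
    simp [sub_dotProduct, h1, h2]

theorem bz_root (m : ℕ) (y : Fin (2 * m + 1) → Fin (2 * m + 1) → Fin (2 * m + 1) → R)
    (hy1 : ∀ a b c, y b a c = -y a b c) (hy2 : ∀ a b c, y a c b = -y a b c)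
    (𝒜 : Finset (Finset (Fin (2 * m + 1)))) (h3 : ∀ A ∈ 𝒜, A.card = 3) (hm : 𝒜.card = m)
    (i j : Fin (2 * m + 1)) :
    bz (2 * m + 1) (gaGen i * ((∏ B ∈ 𝒜, WW y B :
        Subalgebra.center R (GA R (Fin (2 * m + 1)))) : GA R (Fin (2 * m + 1)))) =
    bz (2 * m + 1) (gaGen j * ((∏ B ∈ 𝒜, WW y B :
        Subalgebra.center R (GA R (Fin (2 * m + 1)))) : GA R (Fin (2 * m + 1)))) := by
  obtain ⟨s, p, q, h, hv⟩ := WW_prod m y hy1 hy2 𝒜 h3 hm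
  have hv := hv (fun _ => 1) (by simp)
  have := bz_zero m (ev i - ev j) p q (fun _ => 1) 0 rfl (by simp [sub_dotProduct])
    (fun t => (hv t).1) (fun t => (hv t).2)
  rw [map_sub, sub_mul, map_sub, sub_eq_zero] at this
  rw [h, SetLike.val_smul, mul_smul_comm, mul_smul_comm, map_smul, map_smul, gaGen, gaGen, this]

theorem bz_disc (m : ℕ) (y : Fin (2 * m + 1) → Fin (2 * m + 1) → Fin (2 * m + 1) → R)
    (hy1 : ∀ a b c, y b a c = -y a b c) (hy2 : ∀ a b c, y a c b = -y a b c)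
    (𝒜 : Finset (Finset (Fin (2 * m + 1)))) (h3 : ∀ A ∈ 𝒜, A.card = 3) (hm : 𝒜.card = m)
    (i : Fin (2 * m + 1)) (hc : ¬ (incGraph 𝒜).Connected) :
    bz (2 * m + 1) (gaGen i * ((∏ B ∈ 𝒜, WW y B :
        Subalgebra.center R (GA R (Fin (2 * m + 1)))) : GA R (Fin (2 * m + 1)))) = 0 := by
  obtain ⟨s, p, q, h, hv⟩ := WW_prod m y hy1 hy2 𝒜 h3 hm
  have hj : ∃ j, ¬ (incGraph 𝒜).Reachable (Sum.inr i) (Sum.inr j) := by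
    by_contra! hcon
    apply hc
    rw [SimpleGraph.connected_iff_exists_forall_reachable]
    refine ⟨Sum.inr i, ?_⟩
    rintro (A | j)
    · obtain ⟨x, hx⟩ : A.1.Nonempty := by
        rw [← Finset.card_pos, h3 A.1 A.2]; norm_num
      exact (hcon x).trans ((adj_lr 𝒜 A x).2 hx).symm.reachable
    · exact hcon j
  obtain ⟨j, hj⟩ := hj
  let v : Fin (2 * m + 1) → R := fun x =>
    if (incGraph 𝒜).Reachable (Sum.inr i) (Sum.inr x) then 0 else 1
  have hv := hv v (by
    intro B hB x hx z hz
    have a1 := ((adj_lr 𝒜 ⟨B, hB⟩ x).2 hx).reachable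
    have a2 := ((adj_lr 𝒜 ⟨B, hB⟩ z).2 hz).reachable
    have : (incGraph 𝒜).Reachable (Sum.inr i) (Sum.inr x) ↔
        (incGraph 𝒜).Reachable (Sum.inr i) (Sum.inr z) :=
      ⟨fun h => h.trans (a1.symm.trans a2), fun h => h.trans (a2.symm.trans a1)⟩
    simp only [v, this])
  have := bz_zero m (ev i) p q v j (by simp [v, hj])
    (by simp only [ev, single_one_dotProduct, v]; rw [if_pos (SimpleGraph.Reachable.refl _)])
    (fun t => (hv t).1) (fun t => (hv t).2)
  rw [h, SetLike.val_smul, mul_smul_comm, map_smul, gaGen, this, smul_zero]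

theorem det_unitri {n : ℕ} (M : Matrix (Fin n) (Fin n) R) (d : Fin n → ℕ)
    (h1 : ∀ v, M v v = 1) (h2 : ∀ v w, v ≠ w → ¬ d w < d v → M v w = 0) : M.det = 1 := by
  have hb : M.BlockTriangular (OrderDual.toDual ∘ d) := by
    intro v w h
    have h : d v < d w := h
    exact h2 v w (by rintro rfl; omega) (by omega)
  rw [hb.det]
  apply Finset.prod_eq_one
  intro a _
  have : M.toSquareBlock (OrderDual.toDual ∘ d) a = 1 := by
    ext ⟨v, hv⟩ ⟨w, hw⟩
    rw [Matrix.toSquareBlock_def, Matrix.of_apply, Matrix.one_apply]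
    by_cases hvw : v = w
    · subst hvw; simp [h1]
    · have : d v = d w := by
        have := hv.trans hw.symm
        exact this
      rw [if_neg (by simpa using hvw), h2 v w hvw (by omega)]
  rw [this, Matrix.det_one]

theorem idx_bij (m : ℕ) (i : Fin (2 * m + 1)) (b c : Fin m → Fin (2 * m + 1))
    (hs : ∀ v, v ≠ i → ∃ t, (v = b t ∨ v = c t)) : Function.Bijective (idx m i b c) := by
  rw [← Finite.surjective_iff_bijective]
  intro v
  by_cases hv : v = i
  · exact ⟨0, by simp [idx, hv]⟩
  · obtain ⟨t, rfl | rfl⟩ := hs v hv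
    · refine ⟨Fin.succ ⟨2 * t, by omega⟩, ?_⟩
      simp only [idx, Fin.cons_succ]
      simp
    · refine ⟨Fin.succ ⟨2 * t + 1, by omega⟩, ?_⟩
      have e : (2 * (t : ℕ) + 1) / 2 = t := by omega
      simp only [idx, Fin.cons_succ]
      simp [Nat.add_mod, e]

theorem core_det (m : ℕ) (i : Fin (2 * m + 1)) (r b c : Fin m → Fin (2 * m + 1))
    (d : Fin (2 * m + 1) → ℕ)
    (hs : ∀ v, v ≠ i → ∃ t, (v = b t ∨ v = c t) ∧ d (r t) < d v)
    (P : Equiv.Perm (Fin (2 * m + 1))) (hP : ∀ s, P s = idx m i b c s) :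
    (Matrix.of (rows m (ev i) (fun t => ev (b t) - ev (r t)) (fun t => ev (c t) - ev (r t)) :
      Fin (2 * m + 1) → Fin (2 * m + 1) → R)).det = ((Equiv.Perm.sign P : ℤ) : R) := by
  set M := (Matrix.of (rows m (ev i) (fun t => ev (b t) - ev (r t)) (fun t => ev (c t) - ev (r t)) :
      Fin (2 * m + 1) → Fin (2 * m + 1) → R)) with hM
  have h0 : M = (M.submatrix P.symm id).submatrix P id := by
    ext s t; simp
  rw [h0, Matrix.det_permute, det_unitri _ d, mul_one]
  all_goals
    have hrow0 : M 0 = ev i := rfl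
    have hi : P 0 = i := by rw [hP]; simp [idx]
    have hrow : ∀ s : Fin (2 * m), M s.succ = ev (P s.succ) - ev (r ⟨s / 2, by omega⟩) := by
      intro s
      rw [hP]
      change rows m (ev i) (fun t => ev (b t) - ev (r t)) (fun t => ev (c t) - ev (r t)) s.succ = _
      simp only [rows, idx, Fin.cons_succ]
      split_ifs <;> rfl
    have hd : ∀ s : Fin (2 * m), d (r ⟨s / 2, by omega⟩) < d (P s.succ) := by
      intro s
      have hne : P s.succ ≠ i := by
        rw [← hi]; intro h; exact absurd (P.injective h) (Fin.succ_ne_zero s)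
      obtain ⟨t, ht, hlt⟩ := hs _ hne
      have : (⟨s / 2, by omega⟩ : Fin m) = t := by
        rcases ht with ht | ht
        · have : P s.succ = P (Fin.succ ⟨2 * t, by omega⟩) := by
            rw [ht, hP]
            simp only [idx, Fin.cons_succ]
            simp
          have := Fin.succ_injective _ (P.injective this)
          apply Fin.ext
          have := congrArg Fin.val this
          simp at this ⊢
          omega
        · have : P s.succ = P (Fin.succ ⟨2 * t + 1, by omega⟩) := by
            have e : (2 * (t : ℕ) + 1) / 2 = t := by omega
            rw [ht, hP]
            simp only [idx, Fin.cons_succ]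
            simp [Nat.add_mod, e]
          have := Fin.succ_injective _ (P.injective this)
          apply Fin.ext
          have := congrArg Fin.val this
          simp at this ⊢
          omega
      rw [this]
      exact hlt
  · intro v
    obtain ⟨s, rfl⟩ := P.surjective v
    simp only [Matrix.submatrix_apply, Equiv.symm_apply_apply, id]
    refine Fin.cases ?_ (fun s => ?_) s
    · rw [hrow0, hi]; simp
    · rw [hrow]
      have := hd s
      have hne : P s.succ ≠ r ⟨s / 2, by omega⟩ := by intro h; rw [← h] at this; omega
      simp [hne]
  · intro v w hvw hlt
    obtain ⟨s, rfl⟩ := P.surjective v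
    simp only [Matrix.submatrix_apply, Equiv.symm_apply_apply, id]
    revert hvw hlt
    refine Fin.cases ?_ (fun s => ?_) s
    · intro hvw hlt
      rw [hrow0, ← hi]; simp [hvw.symm]
    · intro hvw hlt
      rw [hrow]
      have := hd s
      have hne : w ≠ r ⟨s / 2, by omega⟩ := by intro h; rw [← h] at this; omega
      simp [hne, hvw.symm]

theorem circ {n : ℕ} (y : Fin n → Fin n → Fin n → R)
    (Y : ∀ k : ℕ, (Fin k → Fin (n)) → R)
    (hY : ∀ α, Y 3 α = y (α 0) (α 1) (α 2))
    (hy1 : ∀ a b c, y b a c = -y a b c) (hy2 : ∀ a b c, y a c b = -y a b c)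
    (𝒜 : Finset (Finset (Fin n))) (h3 : ∀ A ∈ 𝒜, A.card = 3) (i : Fin n)
    (a : Σ k : ℕ, Fin k → Fin n) (l : List (Fin n)) (ha : Function.Injective a.2)
    (h : IsCirculation 𝒜 i a l) :
    ∃ r b c, Finset.image a.2 Finset.univ = {r, b, c} ∧ r ≠ b ∧ r ≠ c ∧ b ≠ c ∧ l = [b, c] ∧
      Y a.1 a.2 = y r b c ∧ ∀ hA : Finset.image a.2 Finset.univ ∈ 𝒜,
        (incGraph 𝒜).dist (Sum.inr r) (Sum.inr i) <
        (incGraph 𝒜).dist (Sum.inl ⟨_, hA⟩) (Sum.inr i) := by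
  obtain ⟨k, α⟩ := a
  obtain ⟨μ, hA, hd, hl⟩ := h
  dsimp only at *
  have hk : k = 3 := by
    have := h3 _ hA
    rw [Finset.card_image_of_injective _ ha] at this
    simpa using this
  subst hk
  change Fin 3 at μ
  have h01 : α 0 ≠ α 1 := fun h => absurd (ha h) (by decide)
  have h02 : α 0 ≠ α 2 := fun h => absurd (ha h) (by decide)
  have h12 : α 1 ≠ α 2 := fun h => absurd (ha h) (by decide)
  have him : Finset.image α Finset.univ = {α 0, α 1, α 2} := by
    ext v; simp [Fin.exists_fin_succ, eq_comm]
  have hyy := hY α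
  refine ⟨α μ, α (μ + 1), α (μ + 2), ?_, ?_, ?_, ?_, ?_, ?_, fun _ => hd⟩
  · rw [him]; clear hl hd
    fin_cases μ <;> ext v <;> simp <;> try tauto
  · exact fun h => absurd (ha h) ((by decide : ∀ μ : Fin 3, μ ≠ μ + 1) μ)
  · exact fun h => absurd (ha h) ((by decide : ∀ μ : Fin 3, μ ≠ μ + 2) μ)
  · exact fun h => absurd (ha h) ((by decide : ∀ μ : Fin 3, μ + 1 ≠ μ + 2) μ)
  · rw [hl]; clear hl hd
    fin_cases μ <;> rfl
  · rw [hyy]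
    have key : ∀ μ : Fin 3, y (α 0) (α 1) (α 2) = y (α μ) (α (μ + 1)) (α (μ + 2)) := by
      have k1 : y (α 0) (α 1) (α 2) = y (α 1) (α 2) (α 0) := by
        rw [hy2 (α 1) (α 0) (α 2), hy1 (α 0)]; try simp
      have k2 : y (α 0) (α 1) (α 2) = y (α 2) (α 0) (α 1) := by
        rw [hy1 (α 0) (α 2) (α 1), hy2 (α 0)]; try simp
      intro μ
      fin_cases μ
      · rfl
      · exact k1
      · exact k2
    exact key μ

theorem ofFn_exists {α : Type*} (L : List α) (m : ℕ) (h : L.length = m) :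
    ∃ x : Fin m → α, L = List.ofFn x := by
  subst h; exact ⟨L.get, (List.ofFn_get L).symm⟩

theorem listPerm_ofFn {n : ℕ} (f : Fin n → Fin n) (hf : Function.Injective f) (s : Fin n) :
    listPerm (List.ofFn f) s = f s := by
  have h : (List.ofFn f).length = n ∧ (List.ofFn f).Nodup := ⟨by simp, List.nodup_ofFn.2 hf⟩
  rw [listPerm, dif_pos h]
  simp

theorem amp_eq (m : ℕ) (y : Fin (2 * m + 1) → Fin (2 * m + 1) → Fin (2 * m + 1) → R)
    (Y : ∀ k : ℕ, (Fin k → Fin (2 * m + 1)) → R)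
    (hY : ∀ α, Y 3 α = y (α 0) (α 1) (α 2))
    (hy1 : ∀ a b c, y b a c = -y a b c) (hy2 : ∀ a b c, y a c b = -y a b c)
    (𝒜 : Finset (Finset (Fin (2 * m + 1)))) (h3 : ∀ A ∈ 𝒜, A.card = 3) (hm : 𝒜.card = m)
    (hc : (incGraph 𝒜).Connected) (i : Fin (2 * m + 1))
    (C : Finset (Σ k : ℕ, Fin k → Fin (2 * m + 1))) (pl : List (Fin (2 * m + 1)))
    (hC : RefinedCactus C) (hCA : cactusOf C = 𝒜) (hpl : IsCactusList C i pl) :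
    ((Equiv.Perm.sign (listPerm pl) : ℤ) : R) * ∏ a ∈ C, Y a.1 a.2 =
    bz (2 * m + 1) (gaGen i * ((∏ B ∈ 𝒜, WW y B :
        Subalgebra.center R (GA R (Fin (2 * m + 1)))) : GA R (Fin (2 * m + 1)))) := by
  obtain ⟨L, hnd, hLC, hcirc, rfl⟩ := hpl
  obtain ⟨hC1, hC2, -⟩ := hC
  rw [hCA] at hcirc
  have hcard : C.card = m := by
    refine Eq.trans ?_ hm
    rw [← hCA, cactusOf, Finset.card_image_of_injOn hC2]
  have hlen : L.length = m := by
    refine Eq.trans ?_ hcard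
    rw [← hLC, List.toFinset_card_of_nodup hnd, List.length_map]
  obtain ⟨x, rfl⟩ := ofFn_exists L m hlen
  have hxC : ∀ t, (x t).1 ∈ C := by
    intro t; rw [← hLC, List.mem_toFinset, List.map_ofFn, List.mem_ofFn]; exact ⟨t, rfl⟩
  have hex := fun t => circ y Y hY hy1 hy2 𝒜 h3 i (x t).1 (x t).2 (hC1 _ (hxC t)).2.2
    (hcirc _ (List.mem_ofFn.2 ⟨t, rfl⟩))
  choose r b c him hrb hrc hbc hl hyy hd using hex
  have hprod : ∀ {S : Type _} [CommMonoid S] (g : (Σ k : ℕ, Fin k → Fin (2 * m + 1)) → S),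
      ∏ a ∈ C, g a = ∏ t, g (x t).1 := by
    intro S _ g
    rw [← hLC, List.prod_toFinset g hnd, List.map_ofFn, List.map_ofFn, List.prod_ofFn]
    rfl
  have hs : ∀ v, v ≠ i → ∃ t, (v = b t ∨ v = c t) ∧
      (incGraph 𝒜).dist (Sum.inr (r t)) (Sum.inr i) < (incGraph 𝒜).dist (Sum.inr v) (Sum.inr i) := by
    intro v hv
    obtain ⟨A, hA, hvA, hlt⟩ := closer_block 𝒜 hc v i hv
    have hA' := hA
    rw [← hCA, cactusOf, Finset.mem_image] at hA'
    obtain ⟨a, haC, rfl⟩ := hA'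
    rw [← hLC, List.mem_toFinset, List.map_ofFn, List.mem_ofFn] at haC
    obtain ⟨t, rfl⟩ := haC
    have h1 := hd t hA
    refine ⟨t, ?_, h1.trans hlt⟩
    have hvr : v ≠ r t := by
      rintro rfl
      exact absurd (h1.trans hlt) (lt_irrefl _)
    have h2 : v ∈ ({r t, b t, c t} : Finset _) := by rw [← him t]; exact hvA
    simp only [Finset.mem_insert, Finset.mem_singleton] at h2
    tauto
  have hbij := idx_bij m i b c (fun v hv => (hs v hv).imp fun t h => h.1)
  have hpl : (i :: (List.map Prod.snd (List.ofFn x)).flatten) = List.ofFn (idx m i b c) := by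
    rw [List.ofFn_succ]
    congr 1
    simp only [idx, Fin.cons_succ]
    rw [List.ofFn_mul', List.map_ofFn]
    congr 2
    ext1 t
    have e : (2 * (t : ℕ) + 1) / 2 = t := by omega
    simp only [Function.comp_apply, List.ofFn_succ, List.ofFn_zero]
    simp [hl, Nat.add_mod, e]
  rw [hpl, hprod, ← core_det m i r b c (fun v => (incGraph 𝒜).dist (Sum.inr v) (Sum.inr i)) hs _
    (listPerm_ofFn _ hbij.1), ← bz_prod]
  have hW : ∏ B ∈ 𝒜, WW y B = (∏ t, Y (x t).1.1 (x t).1.2) •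
      ∏ t, zc (ev (b t) - ev (r t)) (ev (c t) - ev (r t)) := by
    rw [← hCA, cactusOf, Finset.prod_image hC2, hprod, ← Finset.prod_smul]
    refine Finset.prod_congr rfl fun t _ => ?_
    rw [him, WW_eq y hy1 hy2 _ _ _ (hrb t) (hrc t) (hbc t), hyy]
    rfl
  rw [hW, SetLike.val_smul, mul_smul_comm, map_smul, smul_eq_mul, mul_comm]
  rfl

theorem inj3 {α : Type*} (x y z : α) (h1 : x ≠ y) (h2 : x ≠ z) (h3 : y ≠ z) :
    Function.Injective ![x, y, z] := by
  intro s t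
  fin_cases s <;> fin_cases t <;> simp [h1, h2, h3, h1.symm, h2.symm, h3.symm]

theorem list_exists {m : ℕ} (𝒜 : Finset (Finset (Fin (2 * m + 1)))) (h3 : ∀ A ∈ 𝒜, A.card = 3)
    (hc : IsCactus 𝒜) :
    ∃ x : Finset (Σ k : ℕ, Fin k → Fin (2 * m + 1)) × Fin (2 * m + 1) × List (Fin (2 * m + 1)),
      RefinedCactus x.1 ∧ cactusOf x.1 = 𝒜 ∧ IsCactusList x.1 x.2.1 x.2.2 := by
  have h : ∀ A : {A // A ∈ 𝒜}, ∃ r b c : Fin (2 * m + 1), A.1 = {r, b, c} ∧ r ≠ b ∧ r ≠ c ∧ b ≠ c ∧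
      (incGraph 𝒜).dist (Sum.inr r) (Sum.inr 0) < (incGraph 𝒜).dist (Sum.inl A) (Sum.inr 0) := by
    intro A
    obtain ⟨r, hr, hd⟩ := closer_elt 𝒜 hc.2.connected 0 A
    have : (A.1.erase r).card = 2 := by rw [Finset.card_erase_of_mem hr, h3 A.1 A.2]
    obtain ⟨b, c, hbc, he⟩ := Finset.card_eq_two.1 this
    have hb : b ∈ A.1.erase r := by rw [he]; simp
    have hcc : c ∈ A.1.erase r := by rw [he]; simp
    refine ⟨r, b, c, ?_, (Finset.ne_of_mem_erase hb).symm, (Finset.ne_of_mem_erase hcc).symm, hbc, hd⟩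
    rw [← he, Finset.insert_erase hr]
  choose r b c hA hrb hrc hbc hd using h
  let a : {A // A ∈ 𝒜} → Σ k : ℕ, Fin k → Fin (2 * m + 1) := fun A => ⟨3, ![r A, b A, c A]⟩
  have him : ∀ A, Finset.image (a A).2 Finset.univ = A.1 := by
    intro A
    rw [hA A]
    ext v
    simp [a, Fin.exists_fin_succ, eq_comm]
  have hinj : Function.Injective a := by
    intro A B h
    apply Subtype.ext
    rw [← him A, ← him B, h]
  have hCA : cactusOf (Finset.univ.image a) = 𝒜 := by
    ext B
    simp only [cactusOf, Finset.mem_image, Finset.mem_univ, true_and, exists_exists_eq_and, him]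
    simp
  refine ⟨(Finset.univ.image a, 0, 0 :: ((Finset.univ.toList.map
    (fun A => (a A, [b A, c A]))).map Prod.snd).flatten), ⟨?_, ?_, ?_⟩, hCA, ?_⟩
  · intro z hz
    obtain ⟨A, -, rfl⟩ := Finset.mem_image.1 hz
    refine ⟨⟨1, rfl⟩, le_rfl, ?_⟩
    exact inj3 _ _ _ (hrb A) (hrc A) (hbc A)
  · intro z hz w hw h
    obtain ⟨A, -, rfl⟩ := Finset.mem_image.1 (Finset.mem_coe.1 hz)
    obtain ⟨B, -, rfl⟩ := Finset.mem_image.1 (Finset.mem_coe.1 hw)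
    simp only [him] at h
    rw [Subtype.ext h]
  · rw [hCA]; exact hc
  · refine ⟨_, ?_, ?_, ?_, rfl⟩
    · rw [List.map_map]
      exact (Finset.nodup_toList _).map hinj
    · ext z
      simp
    · intro z hz
      obtain ⟨A, -, rfl⟩ := List.mem_map.1 hz
      dsimp only
      rw [hCA]
      refine ⟨(0 : Fin 3), by rw [him]; exact A.2, ?_, rfl⟩
      have e : ∀ (B : Finset (Fin (2 * m + 1))) (hB : B ∈ 𝒜), B = A.1 →
          (incGraph 𝒜).dist (Sum.inr (r A)) (Sum.inr 0) <
            (incGraph 𝒜).dist (Sum.inl ⟨B, hB⟩) (Sum.inr 0) := by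
        rintro B hB rfl
        exact hd A
      exact e _ _ (him A)

theorem cactusAmp_eq (m : ℕ) (y : Fin (2 * m + 1) → Fin (2 * m + 1) → Fin (2 * m + 1) → R)
    (Y : ∀ k : ℕ, (Fin k → Fin (2 * m + 1)) → R)
    (hY : ∀ α, Y 3 α = y (α 0) (α 1) (α 2))
    (hy1 : ∀ a b c, y b a c = -y a b c) (hy2 : ∀ a b c, y a c b = -y a b c)
    (𝒜 : Finset (Finset (Fin (2 * m + 1)))) (h3 : ∀ A ∈ 𝒜, A.card = 3)
    (hc : IsCactus 𝒜) (i : Fin (2 * m + 1)) :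
    cactusAmp Y 𝒜 =
    bz (2 * m + 1) (gaGen i * ((∏ B ∈ 𝒜, WW y B :
        Subalgebra.center R (GA R (Fin (2 * m + 1)))) : GA R (Fin (2 * m + 1)))) := by
  have h := list_exists 𝒜 h3 hc
  have ht := (tree_iff 𝒜 h3).1 hc.2
  rw [cactusAmp, dif_pos h, bz_root m y hy1 hy2 𝒜 h3 ht.2 i h.choose.2.1]
  exact amp_eq m y Y hY hy1 hy2 𝒜 h3 ht.2 ht.1 _ _ _ h.choose_spec.1 h.choose_spec.2.1 h.choose_spec.2.2

theorem mem2 {N : ℕ} (y : Fin N → Fin N → Fin N → R) (q : R) :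
    q • ((∑ a, ∑ b, ∑ c, y a b c • (gaGen b * gaGen c)) : GA R (Fin N)) ∈ Mk R (Fin N) 2 := by
  refine Submodule.smul_mem _ _ (Submodule.sum_mem _ fun a _ => Submodule.sum_mem _ fun b _ =>
    Submodule.sum_mem _ fun c _ => Submodule.smul_mem _ _ ?_)
  rw [Mk, pow_two]
  exact Submodule.mul_mem_mul ⟨_, rfl⟩ ⟨_, rfl⟩

end PT

/-- The Pfaffian-tree theorem of Masbaum and Vaintrob: for odd `n = 2m+1` and a completely
antisymmetric `3`-tensor `y`, the Berezin integral
`∫ dχ_n ⋯ dχ_1 χ_i exp(½ Σ y_{α₁α₂α₃} χ_{α₂}χ_{α₃})` equals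
`(-1)^(i-1) Pf(A⁽ⁱ⁾)` where `A_{bc} = Σ_a y_{abc}` with row and column `i` deleted,
and also equals the sum of the amplitudes of all `3`-regular cacti. -/
theorem pfaffian_tree (m : ℕ)
    (y : Fin (2 * m + 1) → Fin (2 * m + 1) → Fin (2 * m + 1) → R)
    (hy1 : ∀ a b c, y b a c = -y a b c) (hy2 : ∀ a b c, y a c b = -y a b c)
    (i : Fin (2 * m + 1)) :
    gaCoef (bint ((List.ofFn (id : Fin (2 * m + 1) → Fin (2 * m + 1))).reverse)
        ((gaGen i : GA R (Fin (2 * m + 1))) * gexp (algebraMap ℚ R (1/2 : ℚ) •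
          ((∑ a : Fin (2 * m + 1), ∑ b : Fin (2 * m + 1), ∑ c : Fin (2 * m + 1),
            y a b c • (gaGen b * gaGen c)) : GA R (Fin (2 * m + 1)))))) =
        (-1 : R) ^ (i : ℕ) *
          pf (fun (s t : Fin (2 * m)) =>
            ∑ a : Fin (2 * m + 1),
              y a (({i}ᶜ : Finset (Fin (2 * m + 1))).orderIsoOfFin
                  (by simp [Finset.card_compl]) s)
                (({i}ᶜ : Finset (Fin (2 * m + 1))).orderIsoOfFin
                  (by simp [Finset.card_compl]) t)) ∧
      gaCoef (bint ((List.ofFn (id : Fin (2 * m + 1) → Fin (2 * m + 1))).reverse)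
        ((gaGen i : GA R (Fin (2 * m + 1))) * gexp (algebraMap ℚ R (1/2 : ℚ) •
          ((∑ a : Fin (2 * m + 1), ∑ b : Fin (2 * m + 1), ∑ c : Fin (2 * m + 1),
            y a b c • (gaGen b * gaGen c)) : GA R (Fin (2 * m + 1)))))) =
        ∑ 𝒜 ∈ Finset.univ.filter (fun 𝒜 : Finset (Finset (Fin (2 * m + 1))) =>
            IsCactus 𝒜 ∧ ∀ A ∈ 𝒜, A.card = 3),
          cactusAmp (fun k α => if h : k = 3 then
            y (α ⟨0, by omega⟩) (α ⟨1, by omega⟩) (α ⟨2, by omega⟩) else 0) 𝒜 := by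
  rw [PT.bz_gexp m i _ (PT.mem2 y _)]
  constructor
  · have h : ((∑ a, ∑ b, ∑ c, y a b c • (gaGen b * gaGen c)) : GA R (Fin (2 * m + 1))) =
        ∑ b, ∑ c, (∑ a, y a b c) • (gaGen b * gaGen c) := by
      rw [Finset.sum_comm]
      refine Finset.sum_congr rfl fun b _ => ?_
      rw [Finset.sum_comm]
      refine Finset.sum_congr rfl fun c _ => ?_
      rw [Finset.sum_smul]
    rw [h, PT.pf_side m (fun b c => ∑ a, y a b c) i]
    simp only [PT.orderIso_eq]
  · rw [PT.cactus_side m y hy1 hy2 i]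
    symm
    have hsub : Finset.univ.filter (fun 𝒜 : Finset (Finset (Fin (2 * m + 1))) =>
        IsCactus 𝒜 ∧ ∀ A ∈ 𝒜, A.card = 3) ⊆
        ((Finset.univ : Finset (Fin (2 * m + 1))).powersetCard 3).powersetCard m := by
      intro 𝒜 h
      obtain ⟨hc, h3⟩ := (Finset.mem_filter.1 h).2
      rw [Finset.mem_powersetCard]
      refine ⟨fun A hA => ?_, ((PT.tree_iff 𝒜 h3).1 hc.2).2⟩
      rw [Finset.mem_powersetCard]
      exact ⟨Finset.subset_univ _, h3 A hA⟩
    rw [← Finset.sum_subset hsub]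
    · refine Finset.sum_congr rfl fun 𝒜 h => ?_
      obtain ⟨hc, h3⟩ := (Finset.mem_filter.1 h).2
      exact PT.cactusAmp_eq m y _ (fun α => by simp) hy1 hy2 𝒜 h3 hc i
    · intro 𝒜 h hn
      rw [Finset.mem_powersetCard] at h
      have h3 : ∀ A ∈ 𝒜, A.card = 3 := fun A hA => (Finset.mem_powersetCard.1 (h.1 hA)).2
      apply PT.bz_disc m y hy1 hy2 𝒜 h3 h.2
      intro hcon
      apply hn
      rw [Finset.mem_filter]
      refine ⟨Finset.mem_univ _, ⟨fun A hA => ?_, (PT.tree_iff 𝒜 h3).2 ⟨hcon, h.2⟩⟩, h3⟩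
      rw [h3 A hA]
      exact ⟨by decide, le_rfl⟩
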